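/- Let t > 0, K > 0, let φ satisfy the smoothing conditions, and let a, b be complex numbers with a + b ≠ 0 and |a|, |b| sufficiently small (so that ζ(2−a−b) ≠ 0 and the only poles of s ↦ I₁₁(s,t) in the half-plane Re s > −1/2 are a double pole at s = 0 and a simple pole at s = −a−b). Then the sum of the residues of I₁₁(·,t) at s = 0 and s = −a−b equals −(2π/t)^{a+b} h(−a−b)[F(−a−b)/(a+b)² + (f(−a−b)/(a+b))(X + g₁ + c₁)] − K^{−a−b} h(−a−b)(G(−a−b)/(a+b))(f(−a−b)/(a+b)), where X = log(2πK/t). -/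

import Mathlib

open Complex MeasureTheory Filter Finset Set
open scoped Real Topology BigOperators

noncomputable section

namespace CHN

/-- `φ` satisfies the smoothing conditions with parameter `μ`. -/
structure SmoothingFn (μ : ℝ) (φ : ℝ → ℝ) : Prop where
  smooth : ContDiff ℝ (⊤ : ℕ∞) φ
  nonneg : ∀ t : ℝ, 0 ≤ φ t
  eq_one : ∀ t : ℝ, 0 ≤ t → t ≤ 1 → φ t = 1
  eq_zero : ∀ t : ℝ, 1 + μ ≤ t → φ t = 0
  deriv_bound : ∀ j : ℕ, ∃ C : ℝ, 0 < C ∧ ∀ t : ℝ, |iteratedDeriv j φ t| ≤ C * μ⁻¹ ^ j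

/-- `ω` is an admissible weight function for `T` with parameter `ν`, support constants
`c₁ < c₂`, derivative constants `Cd`, and scale `T₀` with `T ^ ν ≤ T₀ ≪ T`. -/
structure AdmissibleWeight (c₁ c₂ ν : ℝ) (Cd : ℕ → ℝ) (T T₀ : ℝ) (ω : ℝ → ℂ) : Prop where
  hc₁ : 0 < c₁
  hc₁₂ : c₁ < c₂
  smooth : ContDiff ℝ (⊤ : ℕ∞) ω
  supp : ∀ t : ℝ, ω t ≠ 0 → c₁ * T ≤ t ∧ t ≤ c₂ * T
  hT₀_low : T ^ ν ≤ T₀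
  hT₀_high : T₀ ≤ T
  deriv_bound : ∀ (j : ℕ) (t : ℝ), ‖iteratedDeriv j ω t‖ ≤ Cd j * T₀⁻¹ ^ j

/-- The Fourier transform `ŵ(u) = ∫ ω(t) e^{-2πiut} dt`. -/
def fhat (ω : ℝ → ℂ) (u : ℝ) : ℂ :=
  ∫ t : ℝ, ω t * Complex.exp (-2 * (Real.pi : ℂ) * Complex.I * (u : ℂ) * (t : ℂ))

/-- `f(s) = s ζ(1+s)`, extended by `f(0) = 1`. -/
def fzeta (s : ℂ) : ℂ := if s = 0 then 1 else s * riemannZeta (1 + s)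

/-- `h(s) = 1/ζ(2+s)`. -/
def hzeta (s : ℂ) : ℂ := (riemannZeta (2 + s))⁻¹

/-- `H(s) = -ζ′(2+s)/ζ(2+s)²`. -/
def Hfun (s : ℂ) : ℂ := -deriv riemannZeta (2 + s) / (riemannZeta (2 + s)) ^ 2

/-- `F(s) = s² ζ′(1+s)`. -/
def Ffun (s : ℂ) : ℂ := s ^ 2 * deriv riemannZeta (1 + s)

/-- `G(s) = -2 ∫₀^∞ φ(t) φ′(t) t^s dt`. -/
def Gfun (φ : ℝ → ℝ) (s : ℂ) : ℂ :=
  -2 * ∫ t in Set.Ioi (0 : ℝ), ((φ t * deriv φ t : ℝ) : ℂ) * (t : ℂ) ^ s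

/-- `Φ₂(s) = ∫₀^∞ φ(t)² t^{s-1} dt`. -/
def Phi2 (φ : ℝ → ℝ) (s : ℂ) : ℂ :=
  ∫ t in Set.Ioi (0 : ℝ), ((φ t ^ 2 : ℝ) : ℂ) * (t : ℂ) ^ (s - 1)

/-- The Mellin transform `Φ(s) = ∫₀^∞ φ(t) t^{s-1} dt`. -/
def MellinPhi (φ : ℝ → ℝ) (s : ℂ) : ℂ :=
  ∫ t in Set.Ioi (0 : ℝ), ((φ t : ℝ) : ℂ) * (t : ℂ) ^ (s - 1)

/-- Taylor coefficients `g_j` of `f(s) = sζ(1+s)` at `s = 0`. -/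
def gcoef (j : ℕ) : ℂ := iteratedDeriv j fzeta 0 / (Nat.factorial j : ℂ)

/-- Taylor coefficients `δ_j` of `1/ζ(2+s)` at `s = 0`. -/
def dcoef (j : ℕ) : ℂ := iteratedDeriv j hzeta 0 / (Nat.factorial j : ℂ)

/-- Taylor coefficients `c_j` of `G(s)` at `s = 0`. -/
def ccoef (φ : ℝ → ℝ) (j : ℕ) : ℂ := iteratedDeriv j (Gfun φ) 0 / (Nat.factorial j : ℂ)

/-- The polynomials `Q_j(x,y)`, for `0 ≤ j ≤ 4` (and `0` for `j ≥ 5`). -/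
def Qpoly (φ : ℝ → ℝ) (j : ℕ) (x y : ℝ) : ℂ :=
  let g : ℕ → ℂ := gcoef
  let δ : ℕ → ℂ := dcoef
  let c : ℕ → ℂ := ccoef φ
  let X : ℂ := (x : ℂ)
  let Y : ℂ := (y : ℂ)
  match j with
  | 0 => 16*δ 4 - 16*δ 1*g 3 + 32*δ 3*g 1 + 32*(g 1)^2*δ 2 - 24*δ 0*g 4 + 8*(g 2)^2*δ 0
       + 5*δ 0*(g 1)^4 + 16*δ 1*(g 1)^3 - 8*δ 0*g 1*g 3 + 16*δ 1*g 1*g 2 + 12*δ 0*(g 1)^2*g 2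
       + 12*(g 1)^2*δ 1*c 1 + 12*δ 0*g 1*g 2*c 1 + 8*δ 3*c 1 + 4*δ 0*(g 1)^3*c 1 + 4*δ 0*g 3*c 1
       + 8*δ 1*g 2*c 1 + 16*g 1*δ 2*c 1 - 4*δ 2*c 2 - 6*(g 1)^2*δ 0*c 2 - 4*δ 0*g 2*c 2
       - 8*g 1*δ 1*c 2 + 4*g 1*δ 0*c 3 + 2*δ 1*c 3 - δ 0*c 4
  | 1 => (4*δ 0*g 3 + 12*δ 0*g 1*g 2 + 4*δ 0*(g 1)^3 + 8*δ 1*g 2 + 12*δ 1*(g 1)^2 + 16*δ 2*g 1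
       + 8*δ 3 - 4*c 1*δ 0*g 2 - 6*c 1*δ 0*(g 1)^2 - 8*c 1*δ 1*g 1 - 4*c 1*δ 2 + 4*c 2*δ 0*g 1
       + 2*c 2*δ 1 - c 3*δ 0) * X
       + (-12*δ 0*g 3 - 4*δ 0*g 1*g 2 - 8*δ 1*g 2 + 4*δ 1*(g 1)^2 + 4*δ 0*(g 1)^3
       + 8*c 1*δ 0*g 2 + 12*c 1*δ 0*(g 1)^2 + 16*c 1*δ 1*g 1 + 8*c 1*δ 2 - 8*c 2*δ 0*g 1
       - 4*c 2*δ 1 + 2*c 3*δ 0) * Y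
  | 2 => (-2*δ 0*g 2 - 3*δ 0*(g 1)^2 - 4*δ 1*g 1 - 2*δ 2 + 2*c 1*δ 0*g 1 + c 1*δ 1
       - c 2*δ 0/2) * X^2
       + (8*δ 0*g 2 + 12*δ 0*(g 1)^2 + 16*δ 1*g 1 + 8*δ 2 - 8*c 1*δ 0*g 1 - 4*c 1*δ 1
       + 2*c 2*δ 0) * X*Y
       + (-5*δ 0*(g 1)^2 - 4*δ 2 - 6*δ 0*g 2 - 8*δ 1*g 1 + 8*c 1*δ 0*g 1 + 4*c 1*δ 1
       - 2*c 2*δ 0) * Y^2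
  | 3 => (2*δ 0*g 1/3 + δ 1/3 - c 1*δ 0/6) * X^3 + (-4*δ 0*g 1 - 2*δ 1 + c 1*δ 0) * X^2*Y
       + (8*δ 0*g 1 + 4*δ 1 - 2*c 1*δ 0) * X*Y^2 + (-4*δ 0*g 1 - 2*δ 1 + 4*c 1*δ 0/3) * Y^3
  | 4 => (1/(24 * riemannZeta 2)) * (-X^4 + 8*X^3*Y - 24*X^2*Y^2 + 32*X*Y^3 - 14*Y^4)
  | _ => 0

/-- The smoothed Dirichlet polynomial `Σ_{n≥1} τ₂(n) n^{-1/2-it} φ(n/K)`. -/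
def tau2Poly (φ : ℝ → ℝ) (K : ℝ) (t : ℝ) : ℂ :=
  ∑' n : ℕ, ((Nat.divisors (n+1)).card : ℂ) *
    ((n+1 : ℕ) : ℂ) ^ (-(1/2 : ℂ) - Complex.I * (t : ℂ)) * ((φ (((n : ℝ)+1)/K) : ℝ) : ℂ)

/-- `D_{2,2;ω}(K) = ∫ ω(t) |Σ_{n≥1} τ₂(n) n^{-1/2-it} φ(n/K)|² dt`. -/
def D22 (φ : ℝ → ℝ) (ω : ℝ → ℂ) (K : ℝ) : ℂ :=
  ∫ t : ℝ, ω t * ((‖tau2Poly φ K t‖ ^ 2 : ℝ) : ℂ)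

/-- The shifted divisor function `σ_A(n)` for a tuple of shifts `A = (a_1, …, a_k)`. -/
def sigmaShift {k : ℕ} (a : Fin k → ℂ) (n : ℕ) : ℂ :=
  ∑ d : Fin k → Fin (n+1), if (∏ i, (d i : ℕ)) = n then ∏ i, ((d i : ℕ) : ℂ) ^ (-a i) else 0

/-- The Ramanujan sum `c_q(r) = Σ_{d ∣ (q, r)} μ(q/d) d`. -/
def ramanujanC (q : ℕ) (r : ℤ) : ℂ :=
  ∑ d ∈ (Nat.gcd q r.natAbs).divisors, ((ArithmeticFunction.moebius (q / d) : ℤ) : ℂ) * (d : ℂ)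

/-- The multiplicative function `g_A(s, n)`. -/
def gA {k : ℕ} (a : Fin k → ℂ) (s : ℂ) (n : ℕ) : ℂ :=
  ∏ p ∈ n.primeFactors,
    (∑' j : ℕ, sigmaShift a (p ^ (j + n.factorization p)) * (p : ℂ) ^ (-(j : ℂ) * s)) /
    (∑' j : ℕ, sigmaShift a (p ^ j) * (p : ℂ) ^ (-(j : ℂ) * s))

/-- The function `G_A(s, n)`. -/
def GA {k : ℕ} (a : Fin k → ℂ) (s : ℂ) (n : ℕ) : ℂ :=
  ∑ d ∈ n.divisors, ((ArithmeticFunction.moebius d : ℤ) : ℂ) * (d : ℂ) ^ s / (Nat.totient d : ℂ) *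
    ∑ e ∈ d.divisors, ((ArithmeticFunction.moebius e : ℤ) : ℂ) / (e : ℂ) ^ s * gA a s (n * e / d)

/-- The shifted convolution sum `D_{F;I,J}(r) = Σ_{m-n=r} σ_I(m) σ_J(n) F(m,n)`. -/
def DFsum {k l : ℕ} (a : Fin k → ℂ) (b : Fin l → ℂ) (F : ℝ → ℝ → ℂ) (r : ℤ) : ℂ :=
  ∑' n : ℕ, if 0 < (n : ℤ) + 1 + r then
      sigmaShift a ((n : ℤ) + 1 + r).toNat * sigmaShift b (n + 1) *
        F ((n : ℝ) + 1 + (r : ℝ)) ((n : ℝ) + 1)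
    else 0

/-- The main term in the additive divisor conjecture. -/
def ADMain {k l : ℕ} (a : Fin k → ℂ) (b : Fin l → ℂ) (F : ℝ → ℝ → ℂ) (r : ℤ) : ℂ :=
  ∑ i₁ : Fin k, ∑ i₂ : Fin l,
    (∏ j₁ ∈ Finset.univ.erase i₁, riemannZeta (1 - a i₁ + a j₁)) *
    (∏ j₂ ∈ Finset.univ.erase i₂, riemannZeta (1 - b i₂ + b j₂)) *
    (∑' q : ℕ, ramanujanC (q + 1) r * GA a (1 - a i₁) (q + 1) * GA b (1 - b i₂) (q + 1) *
        ((q + 1 : ℕ) : ℂ) ^ (a i₁ + b i₂ - 2)) *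
    ∫ x in Set.Ioi (max 0 (r : ℝ)),
      F x (x - (r : ℝ)) * (x : ℂ) ^ (-a i₁) * ((x - (r : ℝ) : ℝ) : ℂ) ^ (-b i₂)

/-- The additive divisor hypothesis `AD_{k,ℓ}(θ, C, β)`. -/
def AD (k l : ℕ) (θ C β : ℝ) : Prop :=
  ∀ ε : ℝ, 0 < ε → ∀ κ : ℝ, 1 ≤ κ → ∀ Dc : ℕ → ℕ → ℝ,
  ∃ C' : ℝ, 0 < C' ∧ ∃ X₀ : ℝ, ∀ P : ℝ, 1 < P → ∀ X Y : ℝ, X₀ ≤ X → 1/2 < Y →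
    X ≤ κ * Y → Y ≤ κ * X →
  ∀ F : ℝ → ℝ → ℂ, ContDiff ℝ (⊤ : ℕ∞) (fun p : ℝ × ℝ => F p.1 p.2) →
    (∀ x y : ℝ, F x y ≠ 0 → (X ≤ x ∧ x ≤ 2 * X) ∧ (Y ≤ y ∧ y ≤ 2 * Y)) →
    (∀ m n : ℕ, ∀ x y : ℝ,
      |x| ^ m * |y| ^ n * ‖iteratedDeriv m (fun x' => iteratedDeriv n (fun y' => F x' y') y) x‖
        ≤ Dc m n * P ^ (m + n)) →
  ∀ a : Fin k → ℂ, ∀ b : Fin l → ℂ, Function.Injective a → Function.Injective b →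
    (∀ i, ‖a i‖ ≤ κ / Real.log X) → (∀ j, ‖b j‖ ≤ κ / Real.log X) →
  ∀ r : ℤ, 1 ≤ r.natAbs → (r.natAbs : ℝ) ≤ κ * X ^ β →
    ‖DFsum a b F r - ADMain a b F r‖ ≤ C' * P ^ C * X ^ (θ + ε)

/-- The mean value `D_{I,J;ω}(K)` of long Dirichlet polynomials with shifted
divisor coefficients. -/
def DmeanShift {k l : ℕ} (a : Fin k → ℂ) (b : Fin l → ℂ) (φ : ℝ → ℝ) (ω : ℝ → ℂ)
    (K : ℝ) : ℂ :=
  ∫ t : ℝ, ω t *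
    (∑' n : ℕ, sigmaShift a (n+1) * ((n+1 : ℕ) : ℂ) ^ (-(1/2 : ℂ) - Complex.I * (t : ℂ)) *
      ((φ (((n : ℝ)+1)/K) : ℝ) : ℂ)) *
    (∑' n : ℕ, sigmaShift b (n+1) * ((n+1 : ℕ) : ℂ) ^ (-(1/2 : ℂ) + Complex.I * (t : ℂ)) *
      ((φ (((n : ℝ)+1)/K) : ℝ) : ℂ))

/-- `Z(I,J) = Π_{i,j} ζ(1 + a_i + b_j)`. -/
def Zfun {k l : ℕ} (a : Fin k → ℂ) (b : Fin l → ℂ) : ℂ :=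
  ∏ i : Fin k, ∏ j : Fin l, riemannZeta (1 + a i + b j)

/-- The Euler product `A(I,J)`. -/
def AEuler {k l : ℕ} (a : Fin k → ℂ) (b : Fin l → ℂ) : ℂ :=
  ∏' p : Nat.Primes,
    ((∏ i : Fin k, ∏ j : Fin l, (1 - ((p : ℕ) : ℂ) ^ (-(1 : ℂ) - a i - b j))) *
      ∑' u : ℕ, sigmaShift a ((p : ℕ) ^ u) * sigmaShift b ((p : ℕ) ^ u) /
        (((p : ℕ) ^ u : ℕ) : ℂ))

/-- `B(I,J) = A(I,J) Z(I,J)`. -/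
def BEuler {k l : ℕ} (a : Fin k → ℂ) (b : Fin l → ℂ) : ℂ := AEuler a b * Zfun a b

/-- The contour integral `∫_{(c)} f(s) ds`, parametrized by `s = c + iu`. -/
def lineInt (c : ℝ) (f : ℂ → ℂ) : ℂ :=
  ∫ u : ℝ, f ((c : ℂ) + (u : ℂ) * Complex.I) * Complex.I

/-- The diagonal main term `M₀(K)`. -/
def M0 {k l : ℕ} (a : Fin k → ℂ) (b : Fin l → ℂ) (φ : ℝ → ℝ) (ω : ℝ → ℂ) (K c : ℝ) : ℂ :=
  fhat ω 0 / (2 * (Real.pi : ℂ) * Complex.I) *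
    lineInt c (fun s => (K : ℂ) ^ s * Phi2 φ s * BEuler (fun i => a i + s) b)

/-- The off-diagonal main term `M₁(K)`. -/
def M1 {k l : ℕ} (a : Fin k → ℂ) (b : Fin l → ℂ) (φ : ℝ → ℝ) (ω : ℝ → ℂ) (K c : ℝ) : ℂ :=
  ∫ t in Set.Ioi (0 : ℝ), ω t *
    ∑ i : Fin k, ∑ j : Fin l,
      ((t / (2 * Real.pi) : ℝ) : ℂ) ^ (-a i - b j) *
      (∏ i' ∈ Finset.univ.erase i, riemannZeta (1 + a i' - a i)) *
      (∏ j' ∈ Finset.univ.erase j, riemannZeta (1 + b j' - b j)) *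
      ((2 * (Real.pi : ℂ) * Complex.I)⁻¹ *
        lineInt c (fun s =>
          Phi2 φ s * ((2 * Real.pi * K / t : ℝ) : ℂ) ^ s *
          (∏ i' ∈ Finset.univ.erase i, ∏ j' ∈ Finset.univ.erase j,
            riemannZeta (1 + (a i' + s) + b j')) *
          riemannZeta (1 - a i - b j - s) *
          AEuler (Function.update a i (-b j - s))
                 (Function.update (fun j' => b j' + s) j (-a i))))

end CHN

namespace CHN

/-- Euler's constant `γ₀` as a complex number. -/
def eulerγ : ℂ := (Real.eulerMascheroniConstant : ℂ)

/-- The term `R₁(a,b)` from Proposition `M₀`. -/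
def R1 (φ : ℝ → ℝ) (K : ℝ) (a b : ℂ) : ℂ :=
  ((Real.log K : ℂ) + ccoef φ 1 + eulerγ) *
      (fzeta (a+b)/(a+b)) * (fzeta a / a) * (fzeta b / b) * hzeta (a+b)
  + 2 * (fzeta (a+b)/(a+b)) * (fzeta a / a) * (fzeta b / b) * Hfun (a+b)
  + (deriv fzeta (a+b)/(a+b) - fzeta (a+b)/(a+b)^2) * (fzeta a / a) * (fzeta b / b) * hzeta (a+b)
  + (fzeta (a+b)/(a+b)) * (deriv fzeta a / a - fzeta a / a^2) * (fzeta b / b) * hzeta (a+b)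
  + (fzeta (a+b)/(a+b)) * (fzeta a / a) * (deriv fzeta b / b - fzeta b / b^2) * hzeta (a+b)

/-- The term `R₁′(a,b)`. -/
def R1' (φ : ℝ → ℝ) (K : ℝ) (a b : ℂ) : ℂ :=
  (a^2)⁻¹ * Gfun φ (-a) * (K : ℂ)^(-a) * (fzeta b / b) * (fzeta (b-a)/(b-a)) *
      fzeta (-a) * hzeta (b-a)
  + (b^2)⁻¹ * Gfun φ (-b) * (K : ℂ)^(-b) * (fzeta a / a) * (fzeta (a-b)/(a-b)) *
      fzeta (-b) * hzeta (a-b)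
  + ((a+b)^2)⁻¹ * Gfun φ (-(a+b)) * (K : ℂ)^(-(a+b)) * (fzeta (-b) / b) * (fzeta (-a) / a) *
      fzeta (-(a+b)) * hzeta (-(a+b))

/-- The term `R₂(a,b;t)`. -/
def R2 (φ : ℝ → ℝ) (K : ℝ) (a b : ℂ) (t : ℝ) : ℂ :=
  let X : ℂ := (Real.log (2 * Real.pi * K / t) : ℂ)
  let g₁ : ℂ := eulerγ
  let c₁ : ℂ := ccoef φ 1
  (-(((2*Real.pi/t : ℝ) : ℂ)^(a+b) * hzeta (-(a+b)) * (fzeta (-a)/a) * (fzeta (-b)/b) *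
      (Ffun (-(a+b))/(a+b)^2 + (fzeta (-(a+b))/(a+b)) * (X + g₁ + c₁)))
  + ((2*Real.pi/t : ℝ) : ℂ)^a * hzeta (b-a) * ((fzeta (-a))^2/a^2) * ((fzeta b)^2/b^2)
  + ((2*Real.pi/t : ℝ) : ℂ)^b * hzeta (a-b) * ((fzeta (-b))^2/b^2) * ((fzeta a)^2/a^2)
  - hzeta (a+b) * (fzeta a / a) * (fzeta b / b) *
      (Ffun (a+b)/(a+b)^2 + (fzeta (a+b)/(a+b)) * (X - g₁ + c₁))
  + (K : ℂ)^(-b) * ((2*Real.pi/t : ℝ) : ℂ)^(a-b) * hzeta (b-a) * (Gfun φ (-b)/b) *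
      (fzeta (b-a)/(b-a)) * (fzeta (-a)/a) * (fzeta b / b)
  + (K : ℂ)^(-a) * ((2*Real.pi/t : ℝ) : ℂ)^(b-a) * hzeta (a-b) * (Gfun φ (-a)/a) *
      (fzeta (a-b)/(a-b)) * (fzeta a / a) * (fzeta (-b)/b)
  - (K : ℂ)^(-(a+b)) * ((2*Real.pi/t : ℝ) : ℂ)^(-(a+b)) * hzeta (a+b) *
      (Gfun φ (-(a+b))/(a+b)) * (fzeta (a+b)/(a+b)) * (fzeta a / a) * (fzeta b / b))

/-- `I₁₁(s,t)`. -/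
def I11 (φ : ℝ → ℝ) (K : ℝ) (a b : ℂ) (s : ℂ) (t : ℝ) : ℂ :=
  (s^2)⁻¹ * Gfun φ s * (K : ℂ)^s * ((2*Real.pi/t : ℝ) : ℂ)^(a+b+s) *
    riemannZeta (1-a-b-s) * fzeta s / riemannZeta (2-a-b)

/-- `I₁₂(s,t)`. -/
def I12 (φ : ℝ → ℝ) (K : ℝ) (a b : ℂ) (s : ℂ) (t : ℝ) : ℂ :=
  s⁻¹ * Gfun φ s * (K : ℂ)^s * ((2*Real.pi/t : ℝ) : ℂ)^(a+s) *
    riemannZeta (1-a-s) * riemannZeta (1+b+s) / riemannZeta (2+b-a)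

/-- `I₂₁(s,t)`. -/
def I21 (φ : ℝ → ℝ) (K : ℝ) (a b : ℂ) (s : ℂ) (t : ℝ) : ℂ :=
  s⁻¹ * Gfun φ s * (K : ℂ)^s * ((2*Real.pi/t : ℝ) : ℂ)^(b+s) *
    riemannZeta (1-b-s) * riemannZeta (1+a+s) / riemannZeta (2+a-b)

/-- `I₂₂(s,t)`. -/
def I22 (φ : ℝ → ℝ) (K : ℝ) (a b : ℂ) (s : ℂ) (t : ℝ) : ℂ :=
  -(s^2)⁻¹ * Gfun φ s * (K : ℂ)^s * ((2*Real.pi/t : ℝ) : ℂ)^s *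
    riemannZeta (1+a+b+s) * fzeta (-s) / riemannZeta (2+a+b)

end CHN

namespace CHN


lemma fzeta_eq (s : ℂ) : fzeta s = 1 + s * riemannZeta₀ (1 + s) := by
  unfold fzeta
  split_ifs with h
  · simp [h]
  · rw [riemannZeta_eq_inv_sub_add (by simpa using h)]
    rw [add_sub_cancel_left, mul_add, mul_inv_cancel₀ h]

lemma fzeta_diff : Differentiable ℂ fzeta := by
  have : fzeta = fun s => 1 + s * riemannZeta₀ (1 + s) := funext fzeta_eq
  rw [this]
  fun_prop

lemma fzeta_zero : fzeta 0 = 1 := by simp [fzeta]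

lemma fzeta_hasDerivAt : HasDerivAt fzeta eulerγ 0 := by
  have : fzeta = fun s => 1 + s * riemannZeta₀ (1 + s) := funext fzeta_eq
  rw [this]
  have hd : HasDerivAt (fun s : ℂ => riemannZeta₀ (1 + s))
      (deriv (fun s : ℂ => riemannZeta₀ (1 + s)) 0) 0 := by
    apply DifferentiableAt.hasDerivAt
    fun_prop
  have := ((hasDerivAt_id (0:ℂ)).mul hd).const_add 1
  refine HasDerivAt.congr_deriv (f := fun s : ℂ => 1 + s * riemannZeta₀ (1 + s)) this ?_
  simp [eulerγ]

lemma pd_cont {μ : ℝ} {φ : ℝ → ℝ} (hφ : SmoothingFn μ φ) :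
    Continuous (fun t : ℝ => ((φ t * deriv φ t : ℝ) : ℂ)) := by
  have h1 : Continuous φ := hφ.smooth.continuous
  have h2 : Continuous (deriv φ) := hφ.smooth.continuous_deriv (by simp)
  fun_prop

lemma pd_zero_top {μ : ℝ} (hμ1 : μ < 1/2) {φ : ℝ → ℝ} (hφ : SmoothingFn μ φ) (t : ℝ)
    (ht : 2 ≤ t) : ((φ t * deriv φ t : ℝ) : ℂ) = 0 := by
  simp [hφ.eq_zero t (by linarith)]

lemma pd_zero_bot {μ : ℝ} {φ : ℝ → ℝ} (hφ : SmoothingFn μ φ) (t : ℝ)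
    (h0 : 0 < t) (h1 : t < 1) : ((φ t * deriv φ t : ℝ) : ℂ) = 0 := by
  have : φ =ᶠ[𝓝 t] fun _ => 1 := by
    filter_upwards [Ioo_mem_nhds h0 h1] with x hx
    exact hφ.eq_one x hx.1.le hx.2.le
  have h := this.deriv_eq
  simp at h
  simp [h]

lemma Gfun_diff {μ : ℝ} (hμ1 : μ < 1/2) {φ : ℝ → ℝ} (hφ : SmoothingFn μ φ) :
    Differentiable ℂ (Gfun φ) := by
  have heq : Gfun φ = fun s => -2 * mellin (fun t : ℝ => ((φ t * deriv φ t : ℝ) : ℂ)) (s + 1) := by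
    funext s
    unfold Gfun mellin
    congr 1
    apply integral_congr_ae
    filter_upwards with x
    simp [mul_comm]
  have hm : Differentiable ℂ (mellin (fun t : ℝ => ((φ t * deriv φ t : ℝ) : ℂ))) := by
    intro s
    refine mellin_differentiableAt_of_isBigO_rpow (a := s.re + 1) (b := s.re - 1)
      ((pd_cont hφ).locallyIntegrable.locallyIntegrableOn _) ?_ (by linarith) ?_ (by linarith)
    · refine Asymptotics.IsBigO.of_bound 1 ?_
      filter_upwards [eventually_ge_atTop (2:ℝ)] with x hx
      rw [pd_zero_top hμ1 hφ x hx]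
      simp
    · refine Asymptotics.IsBigO.of_bound 1 ?_
      filter_upwards [Ioo_mem_nhdsGT (show (0:ℝ) < 1 by norm_num)] with x hx
      rw [pd_zero_bot hφ x hx.1 hx.2]
      simp
  rw [heq]
  fun_prop

lemma Gfun_zero {μ : ℝ} (hμ1 : μ < 1/2) {φ : ℝ → ℝ} (hφ : SmoothingFn μ φ) :
    Gfun φ 0 = 1 := by
  unfold Gfun
  simp only [cpow_zero, mul_one]
  have hi : IntegrableOn (fun t : ℝ => ((φ t * deriv φ t : ℝ) : ℂ)) (Ioi 0) := by
    rw [← Ioc_union_Ioi_eq_Ioi (show (0:ℝ) ≤ 2 by norm_num)]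
    refine IntegrableOn.union ?_ ?_
    · exact ((pd_cont hφ).integrableOn_Icc).mono_set Ioc_subset_Icc_self
    · refine (integrableOn_zero (ε' := ℂ)).congr_fun ?_ measurableSet_Ioi
      intro x hx
      exact (pd_zero_top hμ1 hφ x (le_of_lt hx)).symm
  have := integral_Ioi_of_hasDerivAt_of_tendsto' (a := (0:ℝ)) (m := (0:ℂ))
    (f := fun t : ℝ => ((φ t ^ 2 / 2 : ℝ) : ℂ)) (f' := fun t : ℝ => ((φ t * deriv φ t : ℝ) : ℂ))
    ?_ hi ?_
  · rw [this, hφ.eq_one 0 le_rfl zero_le_one]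
    norm_num
  · intro x _
    apply HasDerivAt.ofReal_comp
    have hd : HasDerivAt φ (deriv φ x) x :=
      ((hφ.smooth.differentiable (by simp)) x).hasDerivAt
    refine HasDerivAt.congr_deriv (f := fun t => φ t ^ 2 / 2) ((hd.pow 2).div_const 2) ?_
    simp
    ring
  · refine tendsto_const_nhds.congr' ?_
    filter_upwards [eventually_ge_atTop (2:ℝ)] with x hx
    simp [hφ.eq_zero x (by linarith)]

lemma dslope_an {f : ℂ → ℂ} {z : ℂ} (h : AnalyticAt ℂ f z) : AnalyticAt ℂ (dslope f z) z := by
  obtain ⟨p, hp⟩ := h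
  exact ⟨_, hp.has_fpower_series_dslope_fslope⟩

lemma simple_exp (f : ℂ → ℂ) (z s : ℂ) (h : s ≠ z) :
    f s / (s - z) = f z / (s - z) + dslope f z s := by
  have := sub_smul_dslope f z s
  have h' := sub_ne_zero.2 h
  rw [smul_eq_mul] at this
  field_simp
  linear_combination -this

lemma double_exp (f : ℂ → ℂ) (s : ℂ) (h : s ≠ 0) :
    f s / s ^ 2 = f 0 / s ^ 2 + deriv f 0 / s + dslope (dslope f 0) 0 s := by
  have h1 := simple_exp f 0 s h
  have h2 := simple_exp (dslope f 0) 0 s h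
  simp only [sub_zero, dslope_same] at h1 h2
  have : f s / s ^ 2 = (f s / s) / s := by field_simp
  rw [this, h1, add_div, h2]
  field_simp
  ring

/-- the sum of the residues of `I₁₁(·,t)` at its double pole `s = 0`
and simple pole `s = -a-b`. -/
theorem statement15
    (μ : ℝ) (hμ0 : 0 < μ) (hμ1 : μ < 1/2) (φ : ℝ → ℝ) (hφ : SmoothingFn μ φ)
    (t K : ℝ) (ht : 0 < t) (hK : 0 < K) :
    ∃ ε₀ > (0:ℝ), ∀ a b : ℂ, ‖a‖ < ε₀ → ‖b‖ < ε₀ → a + b ≠ 0 →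
      riemannZeta (2 - a - b) ≠ 0 →
      ∃ (A₀ R₀ Rab : ℂ) (g₀ gab : ℂ → ℂ),
        AnalyticAt ℂ g₀ 0 ∧ AnalyticAt ℂ gab (-(a+b)) ∧
        (∀ᶠ s in 𝓝[≠] (0:ℂ), I11 φ K a b s t = A₀/s^2 + R₀/s + g₀ s) ∧
        (∀ᶠ s in 𝓝[≠] (-(a+b)), I11 φ K a b s t = Rab/(s+a+b) + gab s) ∧
        R₀ + Rab =
          -(((2*Real.pi/t : ℝ) : ℂ)^(a+b) * hzeta (-(a+b)) *
            (Ffun (-(a+b))/(a+b)^2 + (fzeta (-(a+b))/(a+b)) *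
              ((Real.log (2*Real.pi*K/t) : ℂ) + eulerγ + ccoef φ 1)))
          - (K : ℂ)^(-(a+b)) * hzeta (-(a+b)) * (Gfun φ (-(a+b))/(a+b)) *
              (fzeta (-(a+b))/(a+b)) := by
  refine ⟨1, one_pos, ?_⟩
  intro a b _ _ hab hz
  obtain ⟨c, hc⟩ : ∃ c, c = a + b := ⟨_, rfl⟩
  have hzc : 2 - a - b = 2 - c := by rw [hc]; ring
  rw [hzc] at hz
  rw [← hc] at hab ⊢
  have hp : (0:ℝ) < 2 * Real.pi / t := by positivity
  obtain ⟨p, hpdef⟩ : ∃ p : ℝ, p = 2 * Real.pi / t := ⟨_, rfl⟩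
  rw [← hpdef] at hp ⊢
  have hpC : (p : ℂ) ≠ 0 := by exact_mod_cast hp.ne'
  have hKC : (K : ℂ) ≠ 0 := by exact_mod_cast hK.ne'
  have hlog : (Real.log (2 * Real.pi * K / t) : ℂ) = Complex.log p + Complex.log K := by
    rw [show 2 * Real.pi * K / t = p * K by rw [hpdef]; ring, Real.log_mul hp.ne' hK.ne']
    push_cast [Complex.ofReal_log hp.le, Complex.ofReal_log hK.le]
    rfl
  have hGd := Gfun_diff hμ1 hφ
  have hfd := fzeta_diff
  let E : ℂ → ℂ := fun s => Gfun φ s * (K : ℂ) ^ s * (p : ℂ) ^ (c + s) * fzeta s / riemannZeta (2 - c)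
  have hEd : Differentiable ℂ E := by
    have h1 : Differentiable ℂ (fun s : ℂ => (K : ℂ) ^ s) := fun s =>
      (hasDerivAt_id s).const_cpow (Or.inl hKC) |>.differentiableAt
    have h2 : Differentiable ℂ (fun s : ℂ => (p : ℂ) ^ (c + s)) := fun s =>
      ((hasDerivAt_id s).const_add c).const_cpow (Or.inl hpC) |>.differentiableAt
    exact (((hGd.mul h1).mul h2).mul hfd).div_const _
  let P : ℂ → ℂ := fun s => E s * riemannZeta (1 - c - s)
  let Q : ℂ → ℂ := fun s => -(s ^ 2)⁻¹ * E s * fzeta (-(c + s))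
  have hI : ∀ s, I11 φ K a b s t = P s / s ^ 2 := by
    intro s
    simp only [I11, P, E, ← hpdef, ← hc, hzc]
    rw [show 1 - a - b - s = 1 - c - s by rw [hc]; ring]
    ring
  have hIQ : ∀ s, s ≠ -c → I11 φ K a b s t = Q s / (s - -c) := by
    intro s hs
    have hcs : c + s ≠ 0 := fun h => hs (by linear_combination h)
    have hcs' : s - -c ≠ 0 := sub_ne_zero.2 hs
    rw [hI]
    have : fzeta (-(c + s)) = -(s - -c) * riemannZeta (1 - c - s) := by
      rw [fzeta, if_neg (neg_ne_zero.2 hcs)]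
      rw [show 1 + -(c + s) = 1 - c - s by ring]
      ring
    simp only [P, Q, this]
    field_simp
  have hzd : DifferentiableAt ℂ riemannZeta (1 - c) :=
    differentiableAt_riemannZeta (by intro h; apply hab; linear_combination -h)
  have hPan : AnalyticAt ℂ P 0 := by
    refine (hEd.analyticAt 0).mul ?_
    have h1 : AnalyticAt ℂ riemannZeta (1 - c - 0) :=
      analyticOn_riemannZeta _ (by
        rw [sub_zero]
        intro h
        apply hab
        have h' : 1 - c = 1 := h
        linear_combination -h')
    exact h1.comp (f := fun s => 1 - c - s) (by fun_prop)
  have hQan : AnalyticAt ℂ Q (-c) := by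
    refine AnalyticAt.mul (AnalyticAt.mul ?_ (hEd.analyticAt _)) ?_
    · refine AnalyticAt.neg (AnalyticAt.inv (by fun_prop) ?_)
      simpa using hab
    · have : Differentiable ℂ (fun s => fzeta (-(c + s))) := by fun_prop
      exact this.analyticAt _
  have hPder : deriv P 0 = (p : ℂ) ^ c / riemannZeta (2 - c) *
      ((ccoef φ 1 + Complex.log K + Complex.log p + eulerγ) * riemannZeta (1 - c)
        - deriv riemannZeta (1 - c)) := by
    have hG : HasDerivAt (Gfun φ) (ccoef φ 1) 0 := by
      have := (hGd 0).hasDerivAt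
      simpa [ccoef] using this
    have h1 := (hasDerivAt_id (0:ℂ)).const_cpow (c := (K : ℂ)) (Or.inl hKC)
    have h2 := ((hasDerivAt_id (0:ℂ)).const_add c).const_cpow (c := (p : ℂ)) (Or.inl hpC)
    have h3 : HasDerivAt (fun s => riemannZeta (1 - c - s)) (-deriv riemannZeta (1 - c)) 0 := by
      have h4 : HasDerivAt riemannZeta (deriv riemannZeta (1 - c)) (1 - c - 0) := by
        rw [sub_zero]; exact hzd.hasDerivAt
      exact HasDerivAt.comp_const_sub (1 - c) 0 h4
    have h := ((((hG.mul h1).mul h2).mul fzeta_hasDerivAt).div_const (riemannZeta (2 - c))).mul h3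
    have h' := h.deriv
    change deriv P 0 = _ at h'
    rw [h']
    simp [Gfun_zero hμ1 hφ, fzeta_zero]
    ring
  refine ⟨P 0, deriv P 0, Q (-c), dslope (dslope P 0) 0, dslope Q (-c),
    dslope_an (dslope_an hPan), dslope_an hQan, ?_, ?_, ?_⟩
  · filter_upwards [self_mem_nhdsWithin] with s hs
    rw [hI]
    exact double_exp P s hs
  · filter_upwards [self_mem_nhdsWithin] with s hs
    rw [hIQ s hs, simple_exp Q (-c) s hs, show s + a + b = s - -c by rw [hc]; ring]
  · rw [hPder, hlog]
    have hf : fzeta (-c) = -c * riemannZeta (1 - c) := by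
      rw [fzeta, if_neg (neg_ne_zero.2 hab), ← sub_eq_add_neg]
    have hQ : Q (-c) = -(c ^ 2)⁻¹ * (Gfun φ (-c) * (K : ℂ) ^ (-c) * fzeta (-c) / riemannZeta (2 - c)) := by
      simp [Q, E, fzeta_zero]
    rw [hQ]
    simp only [hzeta, Ffun, ← sub_eq_add_neg, hf]
    field_simp
    ring

end CHN
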